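/- Any polynomial f in the jet variables u_0,...,u_n with δf/δu = 0 and f(0,...,0) = 0 equals D_x(g) for some polynomial g in u_0,...,u_{n-1}, where D_x = Σ u_{j+1}∂/∂u_j (no explicit x dependence). -/

import Mathlib

noncomputable section

open MvPolynomial

/-- The total `x`-derivative on the differential polynomial ring `ℝ[u₀, u₁, u₂, ...]`
(variable `j` represents the jet variable `u_j`), determined by `D_x(u_j) = u_{j+1}`. -/
def DxP : Derivation ℝ (MvPolynomial ℕ ℝ) (MvPolynomial ℕ ℝ) :=
  MvPolynomial.mkDerivation ℝ fun j => X (j + 1)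

/-- The derivation `∑ u_i ∂/∂u_i`, which scales each monomial by its degree. -/
def degreeDerivation : Derivation ℝ (MvPolynomial ℕ ℝ) (MvPolynomial ℕ ℝ) :=
  mkDerivation ℝ X

lemma degreeDerivation_monomial (s : ℕ →₀ ℕ) (r : ℝ) :
    degreeDerivation (monomial s r) = (s.degree : ℝ) • monomial s r := by
  have h : ∀ i ∈ s.support, monomial (s - Finsupp.single i 1) (s i : ℝ) • (X i : MvPolynomial ℕ ℝ)
      = monomial s (s i : ℝ) := fun i hi => by
    rw [smul_eq_mul, X, monomial_mul, mul_one,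
      Finsupp.sub_add_single_one_cancel (Finsupp.mem_support_iff.mp hi)]
  rw [degreeDerivation, mkDerivation_monomial, Finsupp.sum, Finset.sum_congr rfl h, ← map_sum,
    smul_monomial, smul_monomial, smul_eq_mul, smul_eq_mul, mul_comm, Finsupp.degree_apply]
  push_cast
  rfl

lemma coeff_degreeDerivation (s : ℕ →₀ ℕ) (p : MvPolynomial ℕ ℝ) :
    coeff s (degreeDerivation p) = s.degree * coeff s p := by
  induction p using MvPolynomial.induction_on' with
  | add p q hp hq => rw [map_add, coeff_add, coeff_add, hp, hq, mul_add]
  | monomial m a =>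
    rw [degreeDerivation_monomial, coeff_smul, smul_eq_mul, coeff_monomial]
    split_ifs with h
    · rw [h]
    · simp

lemma exists_degreeDerivation_add_C (h : MvPolynomial ℕ ℝ) :
    ∃ (k : MvPolynomial ℕ ℝ) (c : ℝ), h = degreeDerivation k + C c := by
  induction h using MvPolynomial.induction_on' with
  | add p q hp hq =>
    obtain ⟨k, c, rfl⟩ := hp
    obtain ⟨l, d, rfl⟩ := hq
    exact ⟨k + l, c + d, by rw [map_add, map_add]; ring⟩
  | monomial m a =>
    by_cases hm : m = 0
    · exact ⟨0, a, by rw [hm, map_zero, zero_add]; rfl⟩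
    · refine ⟨monomial m ((m.degree : ℝ)⁻¹ * a), 0, ?_⟩
      have hd : (m.degree : ℝ) ≠ 0 := by
        rwa [Nat.cast_ne_zero, Ne, Finsupp.degree_eq_zero_iff]
      rw [degreeDerivation_monomial, smul_monomial, smul_eq_mul, mul_inv_cancel_left₀ hd, C_0,
        add_zero]

lemma degreeDerivation_eq_sum {n : ℕ} {f : MvPolynomial ℕ ℝ} (hf : ∀ i ∈ f.vars, i ≤ n) :
    degreeDerivation f = ∑ i ∈ Finset.range (n + 1), X i * pderiv i f := by
  have hsum (p : MvPolynomial ℕ ℝ) :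
      (∑ i ∈ Finset.range (n + 1), (X i : MvPolynomial ℕ ℝ) • pderiv (R := ℝ) i) p =
        ∑ i ∈ Finset.range (n + 1), X i * pderiv i p := by
    rw [← Derivation.coeFnAddMonoidHom_apply, map_sum, Finset.sum_apply]
    rfl
  rw [← hsum]
  refine derivation_eq_of_forall_mem_vars fun j hj => ?_
  rw [hsum, degreeDerivation, mkDerivation_X, Finset.sum_eq_single j]
  · rw [pderiv_X_self, mul_one]
  · intro i _ hij
    rw [pderiv_X_of_ne hij.symm, mul_zero]
  · intro h
    exact absurd (Finset.mem_range_succ_iff.mpr (hf j hj)) h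

lemma DxP_X (j : ℕ) : DxP (X j) = X (j + 1) :=
  mkDerivation_X ..

lemma DxP_degreeDerivation (p : MvPolynomial ℕ ℝ) :
    DxP (degreeDerivation p) = degreeDerivation (DxP p) := by
  have h : ⁅DxP, degreeDerivation⁆ = 0 := derivation_ext fun i => by
    simp [Derivation.commutator_apply, DxP_X, degreeDerivation, mkDerivation_X]
  simpa [Derivation.commutator_apply, sub_eq_zero] using congrArg (fun D => D p) h

lemma coeff_zero_DxP (p : MvPolynomial ℕ ℝ) : coeff 0 (DxP p) = 0 := by
  induction p using MvPolynomial.induction_on with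
  | C a => simp
  | add p q hp hq => rw [map_add, coeff_add, hp, hq, add_zero]
  | mul_X p i hp =>
    rw [← constantCoeff_eq] at hp ⊢
    simp [DxP_X]

lemma pderiv_succ_DxP (m : ℕ) (p : MvPolynomial ℕ ℝ) :
    pderiv (m + 1) (DxP p) = DxP (pderiv (m + 1) p) + pderiv m p := by
  have h : ⁅pderiv (R := ℝ) (m + 1), DxP⁆ = pderiv m := derivation_ext fun i => by
    rw [Derivation.commutator_apply, DxP_X, pderiv_X, pderiv_X, pderiv_X, Pi.single_apply,
      Pi.single_apply, Pi.single_apply]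
    split_ifs <;> simp_all
  rw [← h, Derivation.commutator_apply]
  ring

/-- Repeated integration by parts: `u_i p ≡ (-1)^i u_0 D_x^i p` modulo total derivatives. -/
lemma exists_X_mul_eq_add_DxP (i : ℕ) (p : MvPolynomial ℕ ℝ) :
    ∃ h, X i * p = X 0 * (((-1 : ℝ) ^ i) • (fun p => DxP p)^[i] p) + DxP h := by
  induction i generalizing p with
  | zero => exact ⟨0, by simp⟩
  | succ i ih =>
    obtain ⟨h, hh⟩ := ih (DxP p)
    refine ⟨X i * p - h, ?_⟩
    rw [map_sub, Derivation.leibniz, DxP_X, smul_eq_mul, smul_eq_mul, hh, Function.iterate_succ_apply,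
      pow_succ, mul_neg_one, neg_smul]
    ring

lemma notMem_vars_of_pderiv_eq_zero {i : ℕ} {p : MvPolynomial ℕ ℝ} (h : pderiv i p = 0) :
    i ∉ p.vars := by
  rw [mem_vars_iff_mem_support]
  rintro ⟨d, hd, hi⟩
  have hc := coeff_pderiv (i := i) p (d - Finsupp.single i 1)
  rw [h, coeff_zero, Finsupp.sub_add_single_one_cancel (Finsupp.mem_support_iff.mp hi)] at hc
  exact mul_ne_zero (mem_support_iff.mp hd) (Nat.cast_add_one_ne_zero _) hc.symm

lemma lt_of_mem_vars_of_DxP {n : ℕ} {g : MvPolynomial ℕ ℝ} (hg : ∀ i ∈ (DxP g).vars, i ≤ n)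
    {i : ℕ} (hi : i ∈ g.vars) : i < n := by
  by_contra! hni
  have hlarge : pderiv (max i (g.vars.sup id + 1)) g = 0 :=
    pderiv_eq_zero_of_notMem_vars fun hmem => by
      have := Finset.le_sup (f := id) hmem
      simp only [id] at this
      omega
  have hzero := Nat.decreasingInduction' (P := fun m => pderiv m g = 0) (m := i)
    (fun m _ him hm => by
      have hd : pderiv (m + 1) (DxP g) = 0 :=
        pderiv_eq_zero_of_notMem_vars fun hmem => by have := hg _ hmem; omega
      rwa [pderiv_succ_DxP, hm, map_zero, zero_add] at hd) (le_max_left _ _) hlarge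
  exact notMem_vars_of_pderiv_eq_zero hzero hi

/-- exactness of the variational complex in the differential polynomial
setting: a polynomial `f` in `u₀, ..., u_n` with `δf/δu = 0` and zero constant term
is a total `x`-derivative `f = D_x(g)` with `g` a polynomial in `u₀, ..., u_{n-1}`. -/
theorem euler_kernel_is_image_of_Dx (n : ℕ) (f : MvPolynomial ℕ ℝ)
    (hvars : ∀ i ∈ f.vars, i ≤ n)
    (heuler : ∑ i ∈ Finset.range (n + 1),
      ((-1 : ℝ) ^ i) • (fun p => DxP p)^[i] (pderiv i f) = 0)
    (hconst : MvPolynomial.coeff 0 f = 0) :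
    ∃ g : MvPolynomial ℕ ℝ, (∀ i ∈ g.vars, i + 1 ≤ n) ∧ f = DxP g := by
  choose h hh using fun i => exists_X_mul_eq_add_DxP i (pderiv i f)
  have hN : degreeDerivation f = DxP (∑ i ∈ Finset.range (n + 1), h i) := by
    rw [degreeDerivation_eq_sum hvars, Finset.sum_congr rfl fun i _ => hh i,
      Finset.sum_add_distrib, ← Finset.mul_sum, heuler, mul_zero, zero_add, map_sum]
  obtain ⟨k, c, hk⟩ := exists_degreeDerivation_add_C (∑ i ∈ Finset.range (n + 1), h i)
  rw [hk, map_add, derivation_C, add_zero, DxP_degreeDerivation] at hN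
  have hf : f = DxP k := by
    ext s
    by_cases hs : s = 0
    · rw [hs, hconst, coeff_zero_DxP]
    · have hd : (s.degree : ℝ) ≠ 0 := by
        rwa [Nat.cast_ne_zero, Ne, Finsupp.degree_eq_zero_iff]
      have hc := congrArg (coeff s) hN
      rw [coeff_degreeDerivation, coeff_degreeDerivation] at hc
      exact mul_left_cancel₀ hd hc
  exact ⟨k, fun i hi => lt_of_mem_vars_of_DxP (hf ▸ hvars) hi, hf⟩
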